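/- arXiv:1811.08667 — 4 statements merged into one kernel-verified Lean document; each statement's English description precedes it below -/
import Mathlib

section
/- Lemma 2.1 (Z-linearity of a shifted C-linear function): Let C = {C_k}_{k∈K} be a finite partition of S = (Fin M → ℕ), let Z = {Z_j}_{j∈J} be a refinement of C, and let H : S → ℝ be a C-linear function. Fix u ∈ (Fin M → ℤ) with u_i ∈ {−1,0,1} for all i, and define G : S → ℝ by G(n) = H(n+u) if n+u ∈ S (i.e. (n_i : ℤ) + u_i ≥ 0 for all i) and G(n) = 0 otherwise. Then G is Z-linear, i.e. there exist reals g_{j,0}, g_{j,i} (j ∈ J, i ∈ Fin M) such that G(n) = g_{z(n),0} + Σ_i g_{z(n),i}·n_i for every n ∈ S, where z(n) is the index of the component of Z containing n. -/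
open Finset

/-- The set of candidate nearest-neighbor steps: all `u : Fin M → ℤ` with entries in `{-1,0,1}`. -/
def steps (M : ℕ) : Finset (Fin M → ℤ) :=
  Fintype.piFinset (fun _ => ({-1, 0, 1} : Finset ℤ))

/-- The allowed steps from state `n`: entries in `{-1,0,1}` and `n + u ≥ 0` componentwise. -/
def nbhd {M : ℕ} (n : Fin M → ℕ) : Finset (Fin M → ℤ) :=
  (steps M).filter (fun u => ∀ i, 0 ≤ (n i : ℤ) + u i)

/-- The state `n + u`. -/
def shift {M : ℕ} (n : Fin M → ℕ) (u : Fin M → ℤ) : Fin M → ℕ :=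
  fun i => ((n i : ℤ) + u i).toNat

/-- A finite partition of `Fin M → ℕ`, encoded by the component-index-indicating function
`c : (Fin M → ℕ) → K` into a finite index set `K`; all states in the same component
must have the same set of allowed steps. -/
def IsFinPartition {M : ℕ} {K : Type*} [Fintype K] (c : (Fin M → ℕ) → K) : Prop :=
  ∀ n n', c n = c n' → nbhd n = nbhd n'

/-- `H` is `C`-linear with respect to the partition with index function `c`. -/
def IsCLinear {M : ℕ} {K : Type*} [Fintype K] (c : (Fin M → ℕ) → K)
    (H : (Fin M → ℕ) → ℝ) : Prop :=
  ∃ (h0 : K → ℝ) (h : K → Fin M → ℝ),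
    ∀ n, H n = h0 (c n) + ∑ i, h (c n) i * (n i : ℝ)

/-- `z` is a refinement of the partition `c`: for states in the same `Z`-component and any
allowed step `u`, the `C`-component of the shifted state depends only on the `Z`-component
and on `u`. -/
def IsRefinement {M : ℕ} {K J : Type*} [Fintype K] [Fintype J]
    (c : (Fin M → ℕ) → K) (z : (Fin M → ℕ) → J) : Prop :=
  ∀ n n', z n = z n' → ∀ u ∈ nbhd n, c (shift n u) = c (shift n' u)

/-- Lemma 2.1: the shift of a `C`-linear function is `Z`-linear for any refinement `Z` of `C`. -/
theorem shifted_Clinear_is_Zlinear {M : ℕ} (hM : 1 ≤ M)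
    {K J : Type*} [Fintype K] [Fintype J]
    (c : (Fin M → ℕ) → K) (z : (Fin M → ℕ) → J)
    (hc : IsFinPartition c) (hz : IsFinPartition z)
    (hzc : IsRefinement c z)
    (H : (Fin M → ℕ) → ℝ) (hH : IsCLinear c H)
    (u : Fin M → ℤ) (hu : ∀ i, u i = -1 ∨ u i = 0 ∨ u i = 1)
    (G : (Fin M → ℕ) → ℝ)
    (hG : ∀ n, G n = if ∀ i, 0 ≤ (n i : ℤ) + u i then H (shift n u) else 0) :
    IsCLinear z G := by
  obtain ⟨h0, h, hH⟩ := hH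
  have mem_nbhd : ∀ n : Fin M → ℕ, u ∈ nbhd n ↔ ∀ i, 0 ≤ (n i : ℤ) + u i := by
    intro n
    simp only [nbhd, steps, Finset.mem_filter, Fintype.mem_piFinset, Finset.mem_insert,
      Finset.mem_singleton]
    exact and_iff_right hu
  have coeffs : ∀ j, ∃ (a : ℝ) (b : Fin M → ℝ),
      ∀ n, z n = j → G n = a + ∑ i, b i * (n i : ℝ) := by
    intro j
    by_cases hj : ∃ m, z m = j ∧ u ∈ nbhd m
    · obtain ⟨m, hm, hum⟩ := hj
      refine ⟨h0 (c (shift m u)) + ∑ i, h (c (shift m u)) i * (u i : ℝ),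
        h (c (shift m u)), fun n hn => ?_⟩
      have hmn : z m = z n := hm.trans hn.symm
      have hun : ∀ i, 0 ≤ (n i : ℤ) + u i := (mem_nbhd n).1 (hz m n hmn ▸ hum)
      have cast_shift : ∀ i, (shift n u i : ℝ) = n i + u i := by
        intro i
        have := Int.toNat_of_nonneg (hun i)
        exact_mod_cast congrArg (Int.cast : ℤ → ℝ) this
      rw [hG, if_pos hun, hH, ← hzc m n hmn u hum, add_assoc, ← Finset.sum_add_distrib]
      congr 1
      refine Finset.sum_congr rfl fun i _ => ?_
      rw [cast_shift]
      ring
    · refine ⟨0, 0, fun n hn => ?_⟩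
      rw [hG, if_neg fun hun => hj ⟨n, hn, (mem_nbhd n).2 hun⟩]
      simp
  choose a b hab using coeffs
  exact ⟨a, b, fun n => hab (z n) n rfl⟩
end

section
/- Feasibility of the flow problem (Theorem 5.1, feasibility part): Let P be a nearest-neighbor stochastic kernel on S = (Fin M → ℕ). Fix n ∈ S and u ∈ N(n). Let V ⊆ S be the set of all states m such that m − n ∈ {−1,0,1}^M or m − (n+u) ∈ {−1,0,1}^M (componentwise, as integers), i.e. the nearest neighbors of n and of n+u together with n and n+u themselves. Then there exists a nonnegative function φ : S × S → ℝ such that φ(m,m′) = 0 unless m ∈ V, m′ ∈ V, and m′ = m + v for some v ∈ N(m), and such that for every m ∈ S: Σ_{m′∈S} φ(m′,m) − Σ_{m′∈S} φ(m,m′) = P(n+u, m) − P(n, m) (all sums finite). -/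
open Finset

/-- A nearest-neighbor stochastic kernel on `Fin M → ℕ`. -/
def IsNNKernel {M : ℕ} (P : (Fin M → ℕ) → (Fin M → ℕ) → ℝ) : Prop :=
  (∀ n n', 0 ≤ P n n') ∧
  (∀ n n', P n n' ≠ 0 → ∃ u ∈ nbhd n, n' = shift n u) ∧
  (∀ n, ∑ u ∈ nbhd n, P n (shift n u) = 1)

/-- `m` is a nearest neighbor of `n` (incl. `n` itself): `m - n ∈ {-1,0,1}^M` componentwise. -/
def isNear {M : ℕ} (n m : Fin M → ℕ) : Prop :=
  ∀ i, |(m i : ℤ) - (n i : ℤ)| ≤ 1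

theorem exists_mem_nbhd_eq_shift_iff {M : ℕ} {n m : Fin M → ℕ} :
    (∃ v ∈ nbhd n, m = shift n v) ↔ isNear n m := by
  constructor
  · rintro ⟨v, hv, rfl⟩ i
    simp only [nbhd, steps, mem_filter, Fintype.mem_piFinset, mem_insert, mem_singleton] at hv
    have h₁ := hv.1 i
    have h₂ := hv.2 i
    rw [abs_le]
    simp only [shift]
    omega
  · intro h
    refine ⟨fun i => (m i : ℤ) - n i, ?_, ?_⟩
    · simp only [nbhd, steps, mem_filter, Fintype.mem_piFinset, mem_insert, mem_singleton]
      refine ⟨fun i => ?_, fun i => by omega⟩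
      have := abs_le.1 (h i)
      omega
    · funext i
      simp [shift]

theorem isNear_symm {M : ℕ} {n m : Fin M → ℕ} (h : isNear n m) : isNear m n :=
  fun i => by simpa [abs_sub_comm] using h i

theorem isNear_refl {M : ℕ} (n : Fin M → ℕ) : isNear n n :=
  fun i => by simp

theorem shift_injOn_nbhd {M : ℕ} (n : Fin M → ℕ) : Set.InjOn (shift n) (nbhd n) := by
  intro v hv w hw h
  have hv' := (mem_filter.1 (mem_coe.1 hv)).2
  have hw' := (mem_filter.1 (mem_coe.1 hw)).2
  funext i
  have h₁ := congrFun h i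
  have h₂ := hv' i
  have h₃ := hw' i
  simp only [shift] at h₁
  omega

theorem IsNNKernel.isNear_of_ne_zero {M : ℕ} {P : (Fin M → ℕ) → (Fin M → ℕ) → ℝ}
    (hP : IsNNKernel P) {n m : Fin M → ℕ} (h : P n m ≠ 0) : isNear n m :=
  exists_mem_nbhd_eq_shift_iff.1 (hP.2.1 n m h)

theorem IsNNKernel.hasSum_one {M : ℕ} {P : (Fin M → ℕ) → (Fin M → ℕ) → ℝ}
    (hP : IsNNKernel P) (n : Fin M → ℕ) : HasSum (P n) 1 := by
  rw [← hP.2.2 n, ← sum_image (f := P n) (shift_injOn_nbhd n)]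
  refine hasSum_sum_of_ne_finset_zero fun m hm => ?_
  by_contra h
  obtain ⟨v, hv, rfl⟩ := hP.2.1 n m h
  exact hm (mem_image_of_mem _ hv)

/-- The flow that collects the mass `P n` at `n`, moves it along the edge from `n` to `q`, and
distributes it from `q` according to `P q`. -/
def collectFlow {M : ℕ} (P : (Fin M → ℕ) → (Fin M → ℕ) → ℝ) (n q m m' : Fin M → ℕ) : ℝ :=
  (if m' = n then P n m else 0) + (if m = n then if m' = q then 1 else 0 else 0) +
    (if m = q then P q m' else 0)

theorem IsNNKernel.hasSum_collectFlow_in {M : ℕ} {P : (Fin M → ℕ) → (Fin M → ℕ) → ℝ}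
    (hP : IsNNKernel P) (n q m : Fin M → ℕ) :
    HasSum (fun m' => collectFlow P n q m' m)
      ((if m = n then 1 else 0) + (if m = q then 1 else 0) + P q m) := by
  refine HasSum.add (HasSum.add ?_ ?_) (hasSum_ite_eq q (P q m))
  · split_ifs
    · exact hP.hasSum_one n
    · exact hasSum_zero
  · exact hasSum_ite_eq n _

theorem IsNNKernel.hasSum_collectFlow_out {M : ℕ} {P : (Fin M → ℕ) → (Fin M → ℕ) → ℝ}
    (hP : IsNNKernel P) (n q m : Fin M → ℕ) :
    HasSum (fun m' => collectFlow P n q m m')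
      (P n m + (if m = n then 1 else 0) + (if m = q then 1 else 0)) := by
  refine HasSum.add (HasSum.add (hasSum_ite_eq n (P n m)) ?_) ?_
  · split_ifs
    · exact hasSum_ite_eq q _
    · exact hasSum_zero
  · split_ifs
    · exact hP.hasSum_one q
    · exact hasSum_zero

theorem IsNNKernel.collectFlow_nonneg {M : ℕ} {P : (Fin M → ℕ) → (Fin M → ℕ) → ℝ}
    (hP : IsNNKernel P) (n q m m' : Fin M → ℕ) : 0 ≤ collectFlow P n q m m' := by
  have h₁ := hP.1 n m
  have h₂ := hP.1 q m'
  unfold collectFlow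
  split_ifs <;> positivity

theorem collectFlow_ne_zero {M : ℕ} {P : (Fin M → ℕ) → (Fin M → ℕ) → ℝ}
    {n q m m' : Fin M → ℕ} (h : collectFlow P n q m m' ≠ 0) :
    (m' = n ∧ P n m ≠ 0) ∨ (m = n ∧ m' = q) ∨ (m = q ∧ P q m' ≠ 0) := by
  contrapose! h
  obtain ⟨h₁, h₂, h₃⟩ := h
  simp +contextual [collectFlow, ite_eq_right_iff.2 h₁, ite_eq_right_iff.2 h₃, h₂]

/-- Feasibility of the flow problem (Theorem 5.1, feasibility part). -/
theorem flow_problem_feasible {M : ℕ} (hM : 1 ≤ M)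
    (P : (Fin M → ℕ) → (Fin M → ℕ) → ℝ) (hP : IsNNKernel P)
    (n : Fin M → ℕ) (u : Fin M → ℤ) (hu : u ∈ nbhd n) :
    ∃ φ : (Fin M → ℕ) → (Fin M → ℕ) → ℝ,
      (∀ m m', 0 ≤ φ m m') ∧
      (∀ m m', φ m m' ≠ 0 →
        (isNear n m ∨ isNear (shift n u) m) ∧
        (isNear n m' ∨ isNear (shift n u) m') ∧
        ∃ v ∈ nbhd m, m' = shift m v) ∧
      (∀ m, (∑' m', φ m' m) - (∑' m', φ m m') = P (shift n u) m - P n m) := by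
  refine ⟨collectFlow P n (shift n u), hP.collectFlow_nonneg _ _, fun m m' h => ?_, fun m => ?_⟩
  · rw [exists_mem_nbhd_eq_shift_iff]
    rcases collectFlow_ne_zero h with ⟨rfl, hne⟩ | ⟨rfl, rfl⟩ | ⟨rfl, hne⟩
    · have hm := hP.isNear_of_ne_zero hne
      exact ⟨.inl hm, .inl (isNear_refl _), isNear_symm hm⟩
    · exact ⟨.inl (isNear_refl _), .inr (isNear_refl _),
        exists_mem_nbhd_eq_shift_iff.1 ⟨u, hu, rfl⟩⟩
    · have hm := hP.isNear_of_ne_zero hne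
      exact ⟨.inr (isNear_refl _), .inr hm, hm⟩
  · rw [(hP.hasSum_collectFlow_in n (shift n u) m).tsum_eq,
      (hP.hasSum_collectFlow_out n (shift n u) m).tsum_eq]
    ring
end

section
/- Lemma 5.2 (nonpositivity of an affine function on a box via corners and slopes): Fix M ≥ 1. Let I ⊆ Fin M (the set of unbounded dimensions), let L : Fin M → ℕ and U : Fin M → ℕ with L_i ≤ U_i for all i ∉ I. Let B = {n ∈ (Fin M → ℕ) : L_i ≤ n_i for all i, and n_i ≤ U_i for all i ∉ I}, and let ∂B = {n ∈ B : n_i = L_i for all i ∈ I, and n_i ∈ {L_i, U_i} for all i ∉ I} (the finite set of corners). Let h_0 and h_i (i ∈ Fin M) be reals and H(n) = h_0 + Σ_i h_i·n_i. Then H(n) ≤ 0 for all n ∈ B if and only if H(n) ≤ 0 for all n ∈ ∂B and h_i ≤ 0 for all i ∈ I. -/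
open Finset

/-- Lemma 5.2: nonpositivity of an affine function on a box via corners and slopes. -/
theorem affine_nonpos_on_box_iff {M : ℕ} (hM : 1 ≤ M)
    (I : Finset (Fin M)) (L U : Fin M → ℕ)
    (hLU : ∀ i ∉ I, L i ≤ U i)
    (h0 : ℝ) (h : Fin M → ℝ) :
    (∀ n : Fin M → ℕ, (∀ i, L i ≤ n i) → (∀ i ∉ I, n i ≤ U i) →
        h0 + ∑ i, h i * (n i : ℝ) ≤ 0) ↔
      ((∀ n : Fin M → ℕ,
          (∀ i ∈ I, n i = L i) → (∀ i ∉ I, n i = L i ∨ n i = U i) →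
          h0 + ∑ i, h i * (n i : ℝ) ≤ 0) ∧
        ∀ i ∈ I, h i ≤ 0) := by
  constructor
  · intro H
    refine ⟨fun n hI hJ => H n (fun i => ?_) (fun i hi => ?_), fun j hj => ?_⟩
    · by_cases hi : i ∈ I
      · exact (hI i hi).ge
      · rcases hJ i hi with e | e
        · exact e.ge
        · exact e ▸ hLU i hi
    · rcases hJ i hi with e | e
      · exact e ▸ hLU i hi
      · exact e.le
    · by_contra! hpos
      obtain ⟨k, hk⟩ := exists_nat_gt (-(h0 + ∑ i, h i * (L i : ℝ)) / h j)
      rw [div_lt_iff₀ hpos] at hk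
      have hle := H (fun i => L i + if i = j then k else 0) (fun i => Nat.le_add_right _ _)
        (fun i hi => by
          have hij : i ≠ j := fun e => hi (e ▸ hj)
          simpa [hij] using hLU i hi)
      simp only [Nat.cast_add, mul_add, sum_add_distrib, Nat.cast_ite, Nat.cast_zero, mul_ite,
        mul_zero, sum_ite_eq', mem_univ, if_true] at hle
      linarith
  · rintro ⟨hcorner, hslope⟩ n hL hU
    let c : Fin M → ℕ := fun i => if i ∉ I ∧ 0 < h i then U i else L i
    have hc : h0 + ∑ i, h i * (c i : ℝ) ≤ 0 := by
      refine hcorner c (fun i hi => by simp [c, hi]) (fun i hi => ?_)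
      by_cases hp : 0 < h i <;> simp [c, hi, hp]
    refine le_trans (add_le_add_right (sum_le_sum fun i _ => ?_) h0) hc
    by_cases hp : i ∉ I ∧ 0 < h i
    · simp only [c, if_pos hp]
      exact mul_le_mul_of_nonneg_left (Nat.cast_le.mpr (hU i hp.1)) hp.2.le
    · simp only [c, if_neg hp]
      have hi : h i ≤ 0 := by
        by_cases hi : i ∈ I
        · exact hslope i hi
        · exact not_lt.mp fun hlt => hp ⟨hi, hlt⟩
      exact mul_le_mul_of_nonpos_left (Nat.cast_le.mpr (hL i)) hi
end

section
/- Stationary distribution of the perturbed two-node tandem walk with service threshold: Let λ, μ1, μ1*, μ2 be positive reals with λ + max{μ1, μ1*} + μ2 ≤ 1, let T ∈ ℕ, and set ρ1 = λ/μ1, ρ2 = λ/μ1*, σ = λ/μ2, assuming ρ1 < 1, ρ2 < 1 and σ < 1. On S = ℕ × ℕ define the kernel P̄ by: P̄(n, n+(1,0)) = λ; P̄(n, n−(0,1)) = μ2 if n2 ≥ 1; P̄(n, n+(−1,1)) = μ1 if 1 ≤ n1 ≤ T and = μ1* if n1 > T; P̄(n, n) = 1 minus the sum of the above; all other entries of P̄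 are 0. Let C > 0 be determined by C^{−1} = (1−ρ1)^{−1}·(1−ρ1^{T+1})·(1−σ)^{−1} + ρ1^T·ρ2·(1−ρ2)^{−1}·(1−σ)^{−1}, and define π̄ : S → ℝ by π̄(n) = C·ρ1^{n1}·σ^{n2} if n1 ≤ T and π̄(n) = C·ρ1^{T}·ρ2^{n1−T}·σ^{n2} if n1 > T. Then π̄ ≥ 0, π̄ is summable with Σ_{n∈S} π̄(n) = 1, and π̄ satisfies the balance equations: for every n ∈ S, π̄(n) = Σ_{n′∈S} π̄(n′)·P̄(n′, n) (the family being summable). -/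
/-- Transition kernel of the perturbed two-node tandem walk with service threshold `T`:
arrival with probability `lam`, departure from node 2 with probability `mu2` (if node 2 is
nonempty), transfer from node 1 to node 2 with probability `mu1` if `n₁ ≤ T` and `mu1s` if
`n₁ > T` (if node 1 is nonempty), and the complementary self-loop. -/
noncomputable def tandemKernel (lam mu1 mu1s mu2 : ℝ) (T : ℕ) :
    ℕ × ℕ → ℕ × ℕ → ℝ := fun n n' =>
  (if n' = (n.1 + 1, n.2) then lam else 0) +
  (if 1 ≤ n.2 ∧ n' = (n.1, n.2 - 1) then mu2 else 0) +
  (if 1 ≤ n.1 ∧ n' = (n.1 - 1, n.2 + 1) then (if n.1 ≤ T then mu1 else mu1s) else 0) +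
  (if n' = n then
      1 - (lam + (if 1 ≤ n.2 then mu2 else 0) +
        (if 1 ≤ n.1 then (if n.1 ≤ T then mu1 else mu1s) else 0))
    else 0)

/-- The service rate at the first node of the tandem walk, as a function of its queue length. -/
noncomputable def tandemRate (mu1 mu1s : ℝ) (T k : ℕ) : ℝ := if k ≤ T then mu1 else mu1s

lemma hasSum_mul_ite_of_iff_eq {α : Type*} (p c : α → ℝ) (q : α → Prop) [DecidablePred q] (y : α)
    (hq : ∀ x, q x ↔ x = y) :
    HasSum (fun x => p x * if q x then c x else 0) (p y * c y) := by
  have h := hasSum_single (f := fun x => p x * if q x then c x else 0) y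
    (fun x hx => by simp [hq, hx])
  simpa [hq] using h

/-- A product of solutions of the two one-node detailed balance equations solves the global balance
equations of the tandem walk. -/
lemma tandemKernel_balance_of_product (lam mu1 mu1s mu2 : ℝ) (T : ℕ) (f g : ℕ → ℝ)
    (hf : ∀ k, f (k + 1) * tandemRate mu1 mu1s T (k + 1) = lam * f k)
    (hg : ∀ k, g (k + 1) * mu2 = lam * g k) (n : ℕ × ℕ) :
    HasSum (fun n' : ℕ × ℕ => f n'.1 * g n'.2 * tandemKernel lam mu1 mu1s mu2 T n' n)
      (f n.1 * g n.2) := by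
  obtain ⟨a, b⟩ := n
  set p : ℕ × ℕ → ℝ := fun x => f x.1 * g x.2 with hp
  have arrival : HasSum (fun x : ℕ × ℕ => p x * if (a, b) = (x.1 + 1, x.2) then lam else 0)
      (f a * g b * if 1 ≤ a then tandemRate mu1 mu1s T a else 0) := by
    cases a with
    | zero =>
      simp
    | succ k =>
      convert hasSum_mul_ite_of_iff_eq p (fun _ => lam)
        (fun x => (k + 1, b) = (x.1 + 1, x.2)) (k, b)
        (by rintro ⟨u, v⟩; simp only [Prod.mk.injEq]; omega) using 1
      simp only [hp, le_add_iff_nonneg_left, zero_le, if_true]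
      linear_combination g b * hf k
  have departure : HasSum
      (fun x : ℕ × ℕ => p x * if 1 ≤ x.2 ∧ (a, b) = (x.1, x.2 - 1) then mu2 else 0)
      (f a * g b * lam) := by
    convert hasSum_mul_ite_of_iff_eq p (fun _ => mu2)
      (fun x => 1 ≤ x.2 ∧ (a, b) = (x.1, x.2 - 1)) (a, b + 1)
      (by rintro ⟨u, v⟩; simp only [Prod.mk.injEq]; omega) using 1
    simp only [hp]
    linear_combination -f a * hg b
  have transfer : HasSum
      (fun x : ℕ × ℕ => p x * if 1 ≤ x.1 ∧ (a, b) = (x.1 - 1, x.2 + 1) then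
        tandemRate mu1 mu1s T x.1 else 0)
      (f a * g b * if 1 ≤ b then mu2 else 0) := by
    cases b with
    | zero =>
      simp
    | succ k =>
      convert hasSum_mul_ite_of_iff_eq p (fun x => tandemRate mu1 mu1s T x.1)
        (fun x => 1 ≤ x.1 ∧ (a, k + 1) = (x.1 - 1, x.2 + 1)) (a + 1, k)
        (by rintro ⟨u, v⟩; simp only [Prod.mk.injEq]; omega) using 1
      simp only [hp, le_add_iff_nonneg_left, zero_le, if_true]
      linear_combination f a * hg k - g k * hf a
  have stay := hasSum_mul_ite_of_iff_eq p
    (fun x => 1 - (lam + (if 1 ≤ x.2 then mu2 else 0) +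
        (if 1 ≤ x.1 then tandemRate mu1 mu1s T x.1 else 0)))
    (fun x => (a, b) = x) (a, b) (fun x => eq_comm)
  convert ((arrival.add departure).add transfer).add stay using 1
  · funext x
    simp only [tandemKernel, tandemRate, hp, mul_add]
  · simp only [hp]
    ring

/-- The unnormalised queue-length weights at the first node of the tandem walk. -/
noncomputable def tandemWeight (r r' : ℝ) (T k : ℕ) : ℝ :=
  if k ≤ T then r ^ k else r ^ T * r' ^ (k - T)

lemma tandemWeight_nonneg {r r' : ℝ} (hr : 0 ≤ r) (hr' : 0 ≤ r') (T k : ℕ) :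
    0 ≤ tandemWeight r r' T k := by
  unfold tandemWeight
  split_ifs <;> positivity

lemma tandemWeight_succ_mul_rate (lam : ℝ) {mu1 mu1s : ℝ} (hmu1 : mu1 ≠ 0) (hmu1s : mu1s ≠ 0)
    (T k : ℕ) :
    tandemWeight (lam / mu1) (lam / mu1s) T (k + 1) * tandemRate mu1 mu1s T (k + 1) =
      lam * tandemWeight (lam / mu1) (lam / mu1s) T k := by
  have h1 : lam / mu1 * mu1 = lam := div_mul_cancel₀ _ hmu1
  have h2 : lam / mu1s * mu1s = lam := div_mul_cancel₀ _ hmu1s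
  unfold tandemWeight tandemRate
  rcases lt_trichotomy k T with h | rfl | h
  · rw [if_pos (by omega), if_pos (by omega), if_pos (by omega), pow_succ]
    linear_combination (lam / mu1) ^ k * h1
  · rw [if_neg (by omega), if_neg (by omega), if_pos le_rfl, Nat.add_sub_cancel_left, pow_one]
    linear_combination (lam / mu1) ^ k * h2
  · rw [if_neg (by omega), if_neg (by omega), if_neg (by omega), Nat.sub_add_comm h.le, pow_succ]
    linear_combination (lam / mu1) ^ T * (lam / mu1s) ^ (k - T) * h2

lemma hasSum_tandemWeight {r r' : ℝ} (hr : r ≠ 1) (hr'0 : 0 ≤ r') (hr'1 : r' < 1) (T : ℕ) :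
    HasSum (tandemWeight r r' T)
      ((1 - r)⁻¹ * (1 - r ^ (T + 1)) + r ^ T * r' * (1 - r')⁻¹) := by
  have tail : HasSum (fun k => tandemWeight r r' T (k + (T + 1))) (r ^ T * r' * (1 - r')⁻¹) := by
    have h (k : ℕ) : tandemWeight r r' T (k + (T + 1)) = r ^ T * r' * r' ^ k := by
      rw [tandemWeight, if_neg (by omega), show k + (T + 1) - T = k + 1 by omega]
      ring
    simpa only [h] using (hasSum_geometric_of_lt_one hr'0 hr'1).mul_left (r ^ T * r')
  have head : ∑ k ∈ Finset.range (T + 1), tandemWeight r r' T k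
      = ∑ k ∈ Finset.range (T + 1), r ^ k :=
    Finset.sum_congr rfl fun k hk => if_pos (by have := Finset.mem_range.1 hk; omega)
  have h := (hasSum_nat_add_iff (T + 1)).1 tail
  rwa [head, geom_sum_eq hr, ← neg_sub 1 r, ← neg_sub 1 (r ^ (T + 1)), neg_div_neg_eq,
    div_eq_inv_mul, add_comm] at h

/-- Stationary distribution of the perturbed two-node tandem walk with service threshold. -/
theorem tandem_perturbed_stationary
    (lam mu1 mu1s mu2 : ℝ)
    (hlam : 0 < lam) (hmu1 : 0 < mu1) (hmu1s : 0 < mu1s) (hmu2 : 0 < mu2)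
    (hunif : lam + max mu1 mu1s + mu2 ≤ 1) (T : ℕ)
    (hr1 : lam / mu1 < 1) (hr2 : lam / mu1s < 1) (hsig : lam / mu2 < 1)
    (C : ℝ) (hCpos : 0 < C)
    (hC : C⁻¹ = (1 - lam / mu1)⁻¹ * (1 - (lam / mu1) ^ (T + 1)) * (1 - lam / mu2)⁻¹
        + (lam / mu1) ^ T * (lam / mu1s) * (1 - lam / mu1s)⁻¹ * (1 - lam / mu2)⁻¹)
    (πb : ℕ × ℕ → ℝ)
    (hπ : ∀ n : ℕ × ℕ, πb n =
      if n.1 ≤ T then C * (lam / mu1) ^ n.1 * (lam / mu2) ^ n.2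
      else C * (lam / mu1) ^ T * (lam / mu1s) ^ (n.1 - T) * (lam / mu2) ^ n.2) :
    (∀ n, 0 ≤ πb n) ∧ HasSum πb 1 ∧
      ∀ n, HasSum (fun n' => πb n' * tandemKernel lam mu1 mu1s mu2 T n' n) (πb n) := by
  have hπ' : πb = fun n =>
      C * tandemWeight (lam / mu1) (lam / mu1s) T n.1 * (lam / mu2) ^ n.2 := by
    funext n
    rw [hπ, tandemWeight]
    split_ifs <;> ring
  have hw := tandemWeight_nonneg (div_pos hlam hmu1).le (div_pos hlam hmu1s).le T
  have hs : 0 ≤ lam / mu2 := (div_pos hlam hmu2).le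
  have hf := (hasSum_tandemWeight hr1.ne (div_pos hlam hmu1s).le hr2 T).mul_left C
  have hg := hasSum_geometric_of_lt_one hs hsig
  subst hπ'
  refine ⟨fun n => mul_nonneg (mul_nonneg hCpos.le (hw n.1)) (pow_nonneg hs _), ?_, fun n => ?_⟩
  · have h := hf.mul hg (hf.summable.mul_of_nonneg hg.summable
      (fun k => mul_nonneg hCpos.le (hw k)) (fun k => pow_nonneg hs k))
    rwa [mul_assoc, add_mul, ← hC, mul_inv_cancel₀ hCpos.ne'] at h
  · refine tandemKernel_balance_of_product lam mu1 mu1s mu2 T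
      (fun k => C * tandemWeight (lam / mu1) (lam / mu1s) T k) (fun k => (lam / mu2) ^ k)
      (fun k => ?_) (fun k => ?_) n
    · linear_combination C * tandemWeight_succ_mul_rate lam hmu1.ne' hmu1s.ne' T k
    · rw [pow_succ]
      linear_combination (lam / mu2) ^ k * div_mul_cancel₀ lam hmu2.ne'
end
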